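/- Let Σ be a finite alphabet and let S, T ∈ Σ^∞ be infinite sequences over Σ. If T can be obtained from S by inserting or deleting symbols at a set of indices of upper asymptotic density zero, then dim_FS(S) = dim_FS(T) and Dim_FS(S) = Dim_FS(T). -/

import Mathlib

/-- Number of sliding-block occurrences of `w` in `s`:
`N(w,s) = |{i : s[i…i+|w|−1] = w}|`. -/
def slideN {α : Type*} [DecidableEq α] (w s : List α) : ℕ :=
  ((Finset.range (s.length + 1 - w.length)).filter
    (fun i => ((s.drop i).take w.length) = w)).card

/-- Sliding count probability of `w` in `s`: `P(w,s) = N(w,s)/(|s|−|w|+1)`. -/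
noncomputable def slideP {α : Type*} [DecidableEq α] (w s : List α) : ℝ :=
  (slideN w s : ℝ) / ((s.length : ℝ) - (w.length : ℝ) + 1)

/-- `l`-th sliding block entropy of a string, with logarithms base `|α|`.
The convention `0 · log(1/0) = 0` holds automatically since `Real.logb b 0⁻¹ = 0`. -/
noncomputable def slideH {α : Type*} [Fintype α] [DecidableEq α] (l : ℕ) (x : List α) : ℝ :=
  (1 / (l : ℝ)) * ∑ w : Fin l → α,
    slideP (List.ofFn w) x * Real.logb (Fintype.card α) (slideP (List.ofFn w) x)⁻¹

/-- The prefix `S[0…n]` of a sequence, i.e. its first `n+1` symbols. -/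
def pre {α : Type*} (S : ℕ → α) (n : ℕ) : List α := List.ofFn (fun i : Fin (n + 1) => S i)

/-- Finite-state dimension via sliding block entropies:
`dim_FS(S) = inf_{l ≥ 1} liminf_{n→∞} H_l(S[0…n])`. -/
noncomputable def dimFS {α : Type*} [Fintype α] [DecidableEq α] (S : ℕ → α) : ℝ :=
  ⨅ l : ℕ, Filter.liminf (fun n => slideH (l + 1) (pre S n)) Filter.atTop

/-- Finite-state strong dimension:
`Dim_FS(S) = inf_{l ≥ 1} limsup_{n→∞} H_l(S[0…n])`. -/
noncomputable def DimFS {α : Type*} [Fintype α] [DecidableEq α] (S : ℕ → α) : ℝ :=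
  ⨅ l : ℕ, Filter.limsup (fun n => slideH (l + 1) (pre S n)) Filter.atTop
/-- Upper asymptotic density of a set of natural numbers:
`limsup_{n→∞} |I ∩ [0,n)| / n`. -/
noncomputable def upperDensity (I : Set ℕ) : ℝ :=
  Filter.limsup (fun n => ((I ∩ Set.Iio n).ncard : ℝ) / n) Filter.atTop

open Filter Topology

/-- `f` is an order isomorphism from the complement of `I` onto the complement of `J`
that carries the symbols of `S` to the symbols of `T`. -/
structure SeqMatch {α : Type*} (S T : ℕ → α) (I J : Set ℕ) (f : ℕ → ℕ) : Prop where
  lt_iff : ∀ m n : ℕ, m ∉ I → n ∉ I → (m < n ↔ f m < f n)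
  maps : ∀ n : ℕ, n ∉ I → f n ∉ J
  surj : ∀ m : ℕ, m ∉ J → ∃ n : ℕ, n ∉ I ∧ f n = m
  apply_eq : ∀ n : ℕ, n ∉ I → T (f n) = S n

namespace SeqMatch

variable {α : Type*} {S T : ℕ → α} {I J : Set ℕ} {f : ℕ → ℕ}

theorem inj (h : SeqMatch S T I J f) {m n : ℕ} (hm : m ∉ I) (hn : n ∉ I) (e : f m = f n) :
    m = n := by
  have h1 := h.lt_iff m n hm hn
  have h2 := h.lt_iff n m hn hm
  omega

theorem exists_symm (h : SeqMatch S T I J f) : ∃ g, SeqMatch T S J I g := by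
  classical
  choose! g hg using h.surj
  refine ⟨g, ⟨fun m n hm hn => ?_, fun n hn => (hg n hn).1, fun m hm => ?_, fun n hn => ?_⟩⟩
  · rw [h.lt_iff _ _ (hg m hm).1 (hg n hn).1, (hg m hm).2, (hg n hn).2]
  · exact ⟨f m, h.maps m hm, h.inj (hg _ (h.maps m hm)).1 hm (hg _ (h.maps m hm)).2⟩
  · rw [← h.apply_eq _ (hg n hn).1, (hg n hn).2]

/-- On a window of `S` that avoids `I` and whose image start begins a window avoiding `J`,
`f` is a translation. -/
theorem apply_add (h : SeqMatch S T I J f) {i L : ℕ} (hI : ∀ j ≤ L, i + j ∉ I)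
    (hJ : ∀ j ≤ L, f i + j ∉ J) : ∀ j ≤ L, f (i + j) = f i + j := by
  intro j
  induction j with
  | zero => simp
  | succ j ih =>
    intro hj
    have e := ih (by omega)
    obtain ⟨k, hk, hfk⟩ := h.surj _ (hJ (j + 1) hj)
    have h0 := hI j (by omega)
    have h1 := hI (j + 1) hj
    have a := h.lt_iff _ _ h0 h1
    have b := h.lt_iff _ _ h0 hk
    have c := h.lt_iff _ _ h1 hk
    have d := h.lt_iff _ _ hk h1
    omega

end SeqMatch

open Classical in
/-- The number of elements of `I` below `n`. -/
noncomputable def countBelow (I : Set ℕ) (n : ℕ) : ℕ :=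
  ((Finset.range n).filter (· ∈ I)).card

theorem ncard_inter_Iio (I : Set ℕ) (n : ℕ) : (I ∩ Set.Iio n).ncard = countBelow I n := by
  classical
  rw [countBelow, ← Set.ncard_coe_finset]
  congr 1
  ext x
  simp [and_comm]

theorem countBelow_mono (I : Set ℕ) : Monotone (countBelow I) := fun _ _ h => by
  unfold countBelow
  gcongr

theorem countBelow_le (I : Set ℕ) (n : ℕ) : countBelow I n ≤ n := by
  classical
  unfold countBelow
  exact (Finset.card_filter_le _ _).trans (by simp)

/-- The number of positions `i < m` at which the word `w` occurs in `S`. -/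
def windowCount {α : Type*} [DecidableEq α] (S : ℕ → α) {L : ℕ} (w : Fin L → α) (m : ℕ) : ℕ :=
  ((Finset.range m).filter (fun i => ∀ j : Fin L, S (i + j) = w j)).card

theorem windowCount_le {α : Type*} [DecidableEq α] (S : ℕ → α) {L : ℕ} (w : Fin L → α) (m : ℕ) :
    windowCount S w m ≤ m :=
  (Finset.card_filter_le _ _).trans (by simp)

namespace SeqMatch

variable {α : Type*} {S T : ℕ → α} {I J : Set ℕ} {f : ℕ → ℕ}

open Classical in
theorem card_overflow_le (h : SeqMatch S T I J f) (m : ℕ) :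
    ((Finset.range m).filter (fun i => i ∉ I ∧ m ≤ f i)).card ≤ countBelow J m := by
  rcases Finset.eq_empty_or_nonempty ((Finset.range m).filter (fun i => i ∉ I ∧ m ≤ f i)) with
    h0 | ⟨i, hi⟩
  · simp [h0]
  simp only [Finset.mem_filter, Finset.mem_range] at hi
  obtain ⟨him, hiI, hfi⟩ := hi
  have h1 : ((Finset.range m).filter (· ∉ J)).card ≤
      ((Finset.range m).filter (fun i => i ∉ I ∧ f i < m)).card := by
    refine (Finset.card_le_card fun j hj => ?_).trans
      (Finset.card_image_le (f := f))
    simp only [Finset.mem_filter, Finset.mem_range] at hj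
    obtain ⟨k, hk, hfk⟩ := h.surj j hj.2
    have := h.lt_iff k i hk hiI
    simp only [Finset.mem_image, Finset.mem_filter, Finset.mem_range]
    exact ⟨k, ⟨by omega, hk, by omega⟩, hfk⟩
  have h2 : ((Finset.range m).filter (· ∈ J)).card + ((Finset.range m).filter (· ∉ J)).card = m := by
    rw [Finset.card_filter_add_card_filter_not, Finset.card_range]
  have h3 : ((Finset.range m).filter (fun i => i ∉ I ∧ f i < m)).card +
      ((Finset.range m).filter (fun i => i ∉ I ∧ m ≤ f i)).card ≤ m := by
    rw [← Finset.card_union_of_disjoint]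
    · refine (Finset.card_le_card (t := Finset.range m) ?_).trans (by simp)
      intro x
      simp only [Finset.mem_union, Finset.mem_filter]
      tauto
    · rw [Finset.disjoint_filter]
      intro x _ hx hx'
      omega
  unfold countBelow
  omega

theorem windowCount_le_add [DecidableEq α] (h : SeqMatch S T I J f) {L : ℕ} (w : Fin L → α)
    (m : ℕ) :
    windowCount S w m ≤
      windowCount T w m + (L + 2) * (countBelow I (m + L) + countBelow J (m + L)) := by
  classical
  set A := (Finset.range m).filter
    (fun i => i ∉ I ∧ f i < m ∧ ∀ j : Fin L, T (f i + j) = w j)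
  set B := (Finset.range m).filter (fun i => i ∉ I ∧ m ≤ f i)
  set C : ℕ → Finset ℕ := fun j => (Finset.range m).filter (fun i => i + j ∈ I)
  set D : ℕ → Finset ℕ := fun j =>
    (Finset.range m).filter (fun i => i ∉ I ∧ f i < m ∧ f i + j ∈ J)
  have hA : A.card ≤ windowCount T w m := by
    refine Finset.card_le_card_of_injOn f (fun i hi => ?_) (fun i hi k hk e => ?_)
    · simp only [A, Finset.coe_filter, Finset.mem_range, Set.mem_ofPred_eq] at hi ⊢
      tauto
    · simp only [A, Finset.coe_filter, Finset.mem_range, Set.mem_ofPred_eq] at hi hk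
      exact h.inj hi.2.1 hk.2.1 e
  have hB : B.card ≤ countBelow J (m + L) :=
    (h.card_overflow_le m).trans (countBelow_mono J (by omega))
  have hC : ((Finset.range (L + 1)).biUnion C).card ≤ (L + 1) * countBelow I (m + L) := by
    refine (Finset.card_biUnion_le_card_mul _ _ (countBelow I (m + L)) fun j hj => ?_).trans
      (by simp)
    rw [Finset.mem_range] at hj
    refine Finset.card_le_card_of_injOn (· + j) (fun i hi => ?_) (fun i _ k _ e => ?_)
    · simp only [C, Finset.coe_filter, Finset.mem_range, Set.mem_ofPred_eq] at hi ⊢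
      exact ⟨by omega, hi.2⟩
    · simpa using e
  have hD : ((Finset.range (L + 1)).biUnion D).card ≤ (L + 1) * countBelow J (m + L) := by
    refine (Finset.card_biUnion_le_card_mul _ _ (countBelow J (m + L)) fun j hj => ?_).trans
      (by simp)
    rw [Finset.mem_range] at hj
    refine Finset.card_le_card_of_injOn (f · + j) (fun i hi => ?_) (fun i hi k hk e => ?_)
    · simp only [D, Finset.coe_filter, Finset.mem_range, Set.mem_ofPred_eq] at hi ⊢
      exact ⟨by omega, hi.2.2.2⟩
    · simp only [D, Finset.coe_filter, Finset.mem_range, Set.mem_ofPred_eq] at hi hk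
      exact h.inj hi.2.1 hk.2.1 (by simpa using e)
  have hsub : (Finset.range m).filter (fun i => ∀ j : Fin L, S (i + j) = w j) ⊆
      (A ∪ B) ∪ ((Finset.range (L + 1)).biUnion C ∪ (Finset.range (L + 1)).biUnion D) := by
    intro i hi
    simp only [Finset.mem_filter, Finset.mem_range] at hi
    by_contra hn
    simp only [A, B, C, D, Finset.mem_union, Finset.mem_biUnion, Finset.mem_filter,
      Finset.mem_range, not_or, not_exists, not_and, not_le] at hn
    obtain ⟨⟨h1, h2⟩, h3, h4⟩ := hn
    have hI : ∀ j ≤ L, i + j ∉ I := fun j hj => h3 j (by omega) hi.1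
    have hi0 : i ∉ I := hI 0 (by omega)
    have hf := h2 hi.1 hi0
    have hJ : ∀ j ≤ L, f i + j ∉ J := fun j hj => h4 j (by omega) hi.1 hi0 hf
    refine h1 hi.1 hi0 hf fun j => ?_
    rw [← h.apply_add hI hJ j j.2.le, h.apply_eq _ (hI j j.2.le), hi.2]
  have := Finset.card_le_card hsub
  have u1 := Finset.card_union_le (A ∪ B)
    ((Finset.range (L + 1)).biUnion C ∪ (Finset.range (L + 1)).biUnion D)
  have u2 := Finset.card_union_le A B
  have u3 := Finset.card_union_le ((Finset.range (L + 1)).biUnion C)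
    ((Finset.range (L + 1)).biUnion D)
  unfold windowCount at hA ⊢
  nlinarith

end SeqMatch

section Entropy

variable {α : Type*} [DecidableEq α]

theorem slideN_pre (S : ℕ → α) {L : ℕ} (w : Fin L → α) (n : ℕ) :
    slideN (List.ofFn w) (pre S n) = windowCount S w (n + 2 - L) := by
  unfold slideN windowCount pre
  simp only [List.length_ofFn]
  congr 1
  refine Finset.filter_congr fun i hi => ?_
  rw [Finset.mem_range] at hi
  constructor
  · intro h j
    have hj := j.2
    have := congrArg (fun l => l[(j : ℕ)]?) h
    simp only [List.getElem?_take, List.getElem?_drop] at this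
    rw [if_pos hj, List.getElem?_eq_getElem (by simp; omega),
      List.getElem?_eq_getElem (by simp)] at this
    simpa [-List.ofFn_succ] using this
  · intro h
    refine List.ext_getElem (by simp; omega) fun j h1 h2 => ?_
    simp only [List.length_ofFn] at h2
    simpa [-List.ofFn_succ] using h ⟨j, h2⟩

theorem slideP_pre (S : ℕ → α) {L : ℕ} (w : Fin L → α) (n : ℕ) :
    slideP (List.ofFn w) (pre S n) =
      (windowCount S w (n + 2 - L) : ℝ) / (((n + 2 : ℕ) : ℝ) - L) := by
  rw [slideP, slideN_pre]
  congr 1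
  simp only [pre, List.length_ofFn]
  push_cast
  ring

theorem slideP_pre_mem_Icc (S : ℕ → α) {L : ℕ} (w : Fin L → α) (n : ℕ) :
    slideP (List.ofFn w) (pre S n) ∈ Set.Icc (0 : ℝ) 1 := by
  rw [slideP_pre]
  have hle := windowCount_le S w (n + 2 - L)
  rcases le_or_gt L (n + 2) with h | h
  · rw [← Nat.cast_sub h]
    exact ⟨by positivity, div_le_one_of_le₀ (by exact_mod_cast hle) (by positivity)⟩
  · have : windowCount S w (n + 2 - L) = 0 := by omega
    simp [this]

theorem tendsto_countBelow_div {I : Set ℕ} (hI : upperDensity I = 0) :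
    Tendsto (fun n => (countBelow I n : ℝ) / n) atTop (𝓝 0) := by
  simp only [upperDensity, ncard_inter_Iio] at hI
  have hle : ∀ n, (countBelow I n : ℝ) / n ≤ 1 := fun n => by
    refine div_le_one_of_le₀ ?_ (by positivity)
    exact_mod_cast countBelow_le I n
  have h0 : ∀ n, 0 ≤ (countBelow I n : ℝ) / n := fun n => by positivity
  have hb : IsBoundedUnder (· ≤ ·) atTop (fun n => (countBelow I n : ℝ) / n) :=
    isBoundedUnder_of ⟨1, hle⟩
  have hb' : IsBoundedUnder (· ≥ ·) atTop (fun n => (countBelow I n : ℝ) / n) :=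
    isBoundedUnder_of ⟨0, h0⟩
  exact tendsto_of_le_liminf_of_limsup_le
    (le_liminf_of_le hb.isCoboundedUnder_ge (Eventually.of_forall h0)) hI.le hb hb'

theorem tendsto_countBelow_div_sub {I : Set ℕ} (hI : upperDensity I = 0) (L : ℕ) :
    Tendsto (fun n : ℕ => (countBelow I (n + 2) : ℝ) / (((n + 2 : ℕ) : ℝ) - L)) atTop (𝓝 0) := by
  have h := (tendsto_countBelow_div hI).mul (tendsto_natCast_div_add_atTop (-(L : ℝ)))
  rw [zero_mul] at h
  refine (h.comp (tendsto_add_atTop_nat 2)).congr fun n => ?_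
  have : ((n + 2 : ℕ) : ℝ) ≠ 0 := by positivity
  simp only [Function.comp_apply]
  rw [div_mul_div_cancel₀ this, sub_eq_add_neg]

theorem SeqMatch.slideP_le_add {S T : ℕ → α} {I J : Set ℕ} {f : ℕ → ℕ}
    (h : SeqMatch S T I J f) {L n : ℕ} (w : Fin L → α) (hn : L ≤ n + 2) :
    slideP (List.ofFn w) (pre S n) ≤ slideP (List.ofFn w) (pre T n) + (L + 2) *
      ((countBelow I (n + 2) : ℝ) / (((n + 2 : ℕ) : ℝ) - L) +
        (countBelow J (n + 2) : ℝ) / (((n + 2 : ℕ) : ℝ) - L)) := by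
  have key := h.windowCount_le_add w (n + 2 - L)
  rw [Nat.sub_add_cancel hn] at key
  have hd : (0 : ℝ) ≤ ((n + 2 : ℕ) : ℝ) - L := sub_nonneg.2 (by exact_mod_cast hn)
  rw [slideP_pre, slideP_pre, ← add_div, ← mul_div_assoc, ← add_div]
  refine div_le_div_of_nonneg_right ?_ hd
  exact_mod_cast key

theorem SeqMatch.tendsto_slideP_sub {S T : ℕ → α} {I J : Set ℕ} {f : ℕ → ℕ}
    (h : SeqMatch S T I J f) (hI : upperDensity I = 0) (hJ : upperDensity J = 0)
    {L : ℕ} (w : Fin L → α) :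
    Tendsto (fun n => slideP (List.ofFn w) (pre S n) - slideP (List.ofFn w) (pre T n))
      atTop (𝓝 0) := by
  obtain ⟨g, hg⟩ := h.exists_symm
  have hlim := ((tendsto_countBelow_div_sub hI L).add
    (tendsto_countBelow_div_sub hJ L)).const_mul ((L : ℝ) + 2)
  simp only [add_zero, mul_zero] at hlim
  refine squeeze_zero_norm' ?_ hlim
  filter_upwards [eventually_ge_atTop L] with n hn
  have h1 := h.slideP_le_add w (n := n) (by omega)
  have h2 := hg.slideP_le_add w (n := n) (by omega)
  rw [Real.norm_eq_abs, abs_le]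
  constructor <;> linarith

theorem tendsto_sub_comp_of_continuousOn {φ : ℝ → ℝ} {K : Set ℝ} (hK : IsCompact K)
    (hφ : ContinuousOn φ K) {u v : ℕ → ℝ} (hu : ∀ n, u n ∈ K) (hv : ∀ n, v n ∈ K)
    (h : Tendsto (fun n => u n - v n) atTop (𝓝 0)) :
    Tendsto (fun n => φ (u n) - φ (v n)) atTop (𝓝 0) := by
  have huc := Metric.uniformContinuousOn_iff.1 (hK.uniformContinuousOn_of_continuous hφ)
  rw [Metric.tendsto_atTop] at h ⊢
  intro ε hε
  obtain ⟨δ, hδ, H⟩ := huc ε hε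
  obtain ⟨N, hN⟩ := h δ hδ
  refine ⟨N, fun n hn => ?_⟩
  have h1 := hN n hn
  rw [dist_zero_right, ← dist_eq_norm] at h1 ⊢
  exact H _ (hu n) _ (hv n) h1

variable [Fintype α]

theorem slideH_eq_sum_negMulLog (l : ℕ) (x : List α) :
    slideH l x = (1 / (l : ℝ)) * ∑ w : Fin l → α,
      Real.negMulLog (slideP (List.ofFn w) x) / Real.log (Fintype.card α) := by
  unfold slideH
  congr 1
  refine Finset.sum_congr rfl fun w _ => ?_
  rw [Real.logb_inv, Real.logb, Real.negMulLog]
  ring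

theorem SeqMatch.tendsto_slideH_sub {S T : ℕ → α} {I J : Set ℕ} {f : ℕ → ℕ}
    (h : SeqMatch S T I J f) (hI : upperDensity I = 0) (hJ : upperDensity J = 0) (l : ℕ) :
    Tendsto (fun n => slideH l (pre S n) - slideH l (pre T n)) atTop (𝓝 0) := by
  simp only [slideH_eq_sum_negMulLog, ← mul_sub, ← Finset.sum_sub_distrib, ← sub_div]
  have := (tendsto_finsetSum (Finset.univ : Finset (Fin l → α)) fun w _ =>
    (tendsto_sub_comp_of_continuousOn isCompact_Icc Real.continuous_negMulLog.continuousOn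
      (slideP_pre_mem_Icc S w) (slideP_pre_mem_Icc T w)
      (h.tendsto_slideP_sub hI hJ w)).div_const (Real.log (Fintype.card α))).const_mul
        (1 / (l : ℝ))
  simpa using this

theorem exists_abs_slideH_pre_le (S : ℕ → α) (l : ℕ) :
    ∃ C, ∀ n, |slideH l (pre S n)| ≤ C := by
  obtain ⟨M, hM⟩ := isCompact_Icc.exists_bound_of_continuousOn
    (Real.continuous_negMulLog.continuousOn (s := Set.Icc (0 : ℝ) 1))
  refine ⟨|1 / (l : ℝ)| * ∑ _w : Fin l → α, M / |Real.log (Fintype.card α)|, fun n => ?_⟩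
  rw [slideH_eq_sum_negMulLog, abs_mul]
  gcongr
  refine (Finset.abs_sum_le_sum_abs _ _).trans (Finset.sum_le_sum fun w _ => ?_)
  rw [abs_div]
  gcongr
  exact hM _ (slideP_pre_mem_Icc S w n)

end Entropy

section Limits

variable {u v : ℕ → ℝ} {C D : ℝ}

theorem limsup_le_limsup_of_tendsto_sub (hu : ∀ n, |u n| ≤ C) (hv : ∀ n, |v n| ≤ D)
    (h : Tendsto (fun n => u n - v n) atTop (𝓝 0)) : limsup u atTop ≤ limsup v atTop := by
  have hua : IsBoundedUnder (· ≥ ·) atTop u :=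
    isBoundedUnder_of ⟨-C, fun n => (abs_le.1 (hu n)).1⟩
  have hvb : IsBoundedUnder (· ≤ ·) atTop v :=
    isBoundedUnder_of ⟨D, fun n => (abs_le.1 (hv n)).2⟩
  refine le_of_forall_pos_lt_add fun ε hε => ?_
  have h1 : ∀ᶠ n in atTop, v n < limsup v atTop + ε / 4 :=
    eventually_lt_of_limsup_lt (by linarith) hvb
  have h2 : ∀ᶠ n in atTop, u n - v n < ε / 4 := h.eventually_lt_const (by linarith)
  have : limsup u atTop ≤ limsup v atTop + ε / 2 := by
    refine limsup_le_of_le hua.isCoboundedUnder_le ?_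
    filter_upwards [h1, h2] with n h1 h2
    linarith
  linarith

theorem liminf_le_liminf_of_tendsto_sub (hu : ∀ n, |u n| ≤ C) (hv : ∀ n, |v n| ≤ D)
    (h : Tendsto (fun n => u n - v n) atTop (𝓝 0)) : liminf u atTop ≤ liminf v atTop := by
  have hua : IsBoundedUnder (· ≥ ·) atTop u :=
    isBoundedUnder_of ⟨-C, fun n => (abs_le.1 (hu n)).1⟩
  have hvb : IsBoundedUnder (· ≤ ·) atTop v :=
    isBoundedUnder_of ⟨D, fun n => (abs_le.1 (hv n)).2⟩
  refine le_of_forall_pos_lt_add fun ε hε => ?_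
  have h1 : ∀ᶠ n in atTop, liminf u atTop - ε / 4 < u n :=
    eventually_lt_of_lt_liminf (by linarith) hua
  have h2 : ∀ᶠ n in atTop, u n - v n < ε / 4 := h.eventually_lt_const (by linarith)
  have : liminf u atTop - ε / 2 ≤ liminf v atTop := by
    refine le_liminf_of_le hvb.isCoboundedUnder_ge ?_
    filter_upwards [h1, h2] with n h1 h2
    linarith
  linarith

end Limits

/-- If `T` is obtained from `S` by deleting the symbols of `S` at a
set `I` of indices of upper asymptotic density zero and inserting symbols at a set `J`
of indices of upper asymptotic density zero (witnessed by the order-preserving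
correspondence `f` between the surviving positions of `S` and the non-inserted
positions of `T`), then `S` and `T` have the same finite-state dimension and the
same finite-state strong dimension. -/
theorem stmt0 {α : Type*} [Fintype α] [DecidableEq α] (hα : 2 ≤ Fintype.card α)
    (S T : ℕ → α) (I J : Set ℕ)
    (hI : upperDensity I = 0) (hJ : upperDensity J = 0)
    (f : ℕ → ℕ)
    (hmono : ∀ m n : ℕ, m ∉ I → n ∉ I → (m < n ↔ f m < f n))
    (hmaps : ∀ n : ℕ, n ∉ I → f n ∉ J)
    (hsurj : ∀ m : ℕ, m ∉ J → ∃ n : ℕ, n ∉ I ∧ f n = m)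
    (hmatch : ∀ n : ℕ, n ∉ I → T (f n) = S n) :
    dimFS S = dimFS T ∧ DimFS S = DimFS T := by
  have h : SeqMatch S T I J f := ⟨hmono, hmaps, hsurj, hmatch⟩
  obtain ⟨g, hg⟩ := h.exists_symm
  refine ⟨iInf_congr fun l => ?_, iInf_congr fun l => ?_⟩ <;>
    obtain ⟨C, hC⟩ := exists_abs_slideH_pre_le S (l + 1) <;>
    obtain ⟨D, hD⟩ := exists_abs_slideH_pre_le T (l + 1)
  · exact (liminf_le_liminf_of_tendsto_sub hC hD (h.tendsto_slideH_sub hI hJ _)).antisymm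
      (liminf_le_liminf_of_tendsto_sub hD hC (hg.tendsto_slideH_sub hJ hI _))
  · exact (limsup_le_limsup_of_tendsto_sub hC hD (h.tendsto_slideH_sub hI hJ _)).antisymm
      (limsup_le_limsup_of_tendsto_sub hD hC (hg.tendsto_slideH_sub hJ hI _))
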